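/- An abelian group G is ℵ₁-free if and only if G is torsion-free and every pure subgroup of G of finite torsion-free rank is free. -/

import Mathlib

/-- An abelian group is `ℵ₁`-free if every countable subgroup is free as a `ℤ`-module. -/
def Aleph1Free (G : Type*) [AddCommGroup G] : Prop :=
  ∀ H : AddSubgroup G, Countable H → Module.Free ℤ ↥H

/-- A subgroup `H` of an abelian group `G` is pure if whenever `x ∈ H` is divisible by a
nonzero integer `n` in `G`, it is divisible by `n` in `H`. -/
def IsPureSubgroup {G : Type*} [AddCommGroup G] (H : AddSubgroup G) : Prop :=
  ∀ x ∈ H, ∀ n : ℤ, n ≠ 0 → (∃ y : G, x = n • y) → ∃ h ∈ H, x = n • h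

namespace Submodule

variable {R M : Type*} [CommRing R] [IsDomain R] [AddCommGroup M] [Module R M]

/-- The pure closure of a submodule `N`: all elements having a nonzero multiple in `N`. -/
def pureClosure (N : Submodule R M) : Submodule R M where
  carrier := {x | ∃ r : R, r ≠ 0 ∧ r • x ∈ N}
  zero_mem' := ⟨1, one_ne_zero, by simp⟩
  add_mem' := by
    rintro x y ⟨r, hr, hx⟩ ⟨s, hs, hy⟩
    refine ⟨r * s, mul_ne_zero hr hs, ?_⟩
    rw [smul_add, mul_comm r s, mul_smul, mul_comm s r, mul_smul r s y]
    exact N.add_mem (N.smul_mem s hx) (N.smul_mem r hy)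
  smul_mem' := by
    rintro c x ⟨r, hr, hx⟩
    exact ⟨r, hr, by rw [smul_comm]; exact N.smul_mem c hx⟩

theorem le_pureClosure (N : Submodule R M) : N ≤ N.pureClosure :=
  fun x hx => ⟨1, one_ne_zero, by simpa using hx⟩

theorem pureClosure_mono {N P : Submodule R M} (h : N ≤ P) : N.pureClosure ≤ P.pureClosure :=
  fun _ ⟨r, hr, hx⟩ => ⟨r, hr, h hx⟩

theorem mem_pureClosure_of_smul_mem {N : Submodule R M} {r : R} (hr : r ≠ 0) {x : M}
    (hx : r • x ∈ N.pureClosure) : x ∈ N.pureClosure := by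
  obtain ⟨s, hs, h⟩ := hx
  exact ⟨s * r, mul_ne_zero hs hr, by rwa [mul_smul]⟩

theorem isTorsionFree_quotient_pureClosure (N : Submodule R M) :
    Module.IsTorsionFree R (M ⧸ N.pureClosure) := by
  rw [Module.isTorsionFree_iff_smul_eq_zero]
  intro r x h
  obtain ⟨x, rfl⟩ := N.pureClosure.mkQ_surjective x
  by_cases hr : r = 0
  · exact Or.inl hr
  · right
    rw [← map_smul, mkQ_apply, Quotient.mk_eq_zero] at h
    rw [mkQ_apply, Quotient.mk_eq_zero]
    exact mem_pureClosure_of_smul_mem hr h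

theorem rank_pureClosure (N : Submodule R M) :
    Module.rank R N.pureClosure = Module.rank R N := by
  rw [← rank_quotient_add_rank_of_isDomain (N.submoduleOf N.pureClosure),
    (submoduleOfEquivOfLe N.le_pureClosure).rank_eq, Module.rank_eq_zero_iff_isTorsion.2, zero_add]
  intro x
  obtain ⟨⟨x, r, hr, hx⟩, rfl⟩ := (N.submoduleOf N.pureClosure).mkQ_surjective x
  refine ⟨⟨r, mem_nonZeroDivisors_of_ne_zero hr⟩, ?_⟩
  change r • (N.submoduleOf N.pureClosure).mkQ _ = 0
  rw [← map_smul, mkQ_apply, Quotient.mk_eq_zero]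
  exact hx

end Submodule

section Chain

variable {R M : Type*} [CommRing R] [Nontrivial R] [AddCommGroup M] [Module R M]

theorem LinearIndepOn.exists_extend_of_free_map_mkQ {N P : Submodule R M} (hNP : N ≤ P)
    (hfree : Module.Free R (P.map N.mkQ)) {s : Set M} (hs : LinearIndepOn R id s)
    (hspan : Submodule.span R s = N) :
    ∃ t, s ⊆ t ∧ LinearIndepOn R id t ∧ Submodule.span R t = P := by
  let b := Module.Free.chooseBasis R (P.map N.mkQ)
  choose f hfP hf using fun i => Submodule.mem_map.1 (b i).2
  have hli : LinearIndependent R (N.mkQ ∘ f) := by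
    have : N.mkQ ∘ f = (P.map N.mkQ).subtype ∘ b := funext hf
    rw [this]
    exact b.linearIndependent.map' _ (Submodule.ker_subtype _)
  have hmap : (Submodule.span R (Set.range f)).map N.mkQ = P.map N.mkQ := by
    have : N.mkQ '' Set.range f = (P.map N.mkQ).subtype '' Set.range b := by
      rw [← Set.range_comp, ← Set.range_comp]
      exact congrArg Set.range (funext hf)
    rw [Submodule.map_span, this, ← Submodule.map_span, b.span_eq, Submodule.map_subtype_top]
  refine ⟨s ∪ Set.range f, Set.subset_union_left,
    LinearIndepOn.union_id_of_quotient (M' := N) (hspan ▸ Submodule.subset_span) hs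
      ((linearIndepOn_range_iff hli.injective.of_comp _).2 hli), ?_⟩
  rw [Submodule.span_union, hspan]
  refine le_antisymm (sup_le hNP (Submodule.span_le.2 (Set.range_subset_iff.2 hfP))) ?_
  have hcomap := Submodule.comap_map_eq N.mkQ (Submodule.span R (Set.range f))
  rw [hmap, N.ker_mkQ, sup_comm] at hcomap
  exact hcomap ▸ Submodule.le_comap_map _ _

/-- The union of a chain of submodules starting at `⊥` with free successive quotients is free. -/
theorem Module.Free.iSup_of_free_map_mkQ {C : ℕ → Submodule R M} (hmono : Monotone C)
    (h0 : C 0 = ⊥) (hfree : ∀ n, Module.Free R ((C (n + 1)).map (C n).mkQ)) :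
    Module.Free R ↥(⨆ n, C n) := by
  choose next hsub hli hspan using
    fun (n : ℕ) (s : {s : Set M // LinearIndepOn R id s ∧ Submodule.span R s = C n}) =>
      LinearIndepOn.exists_extend_of_free_map_mkQ (hmono n.le_succ) (hfree n) s.2.1 s.2.2
  let B : ∀ n, {s : Set M // LinearIndepOn R id s ∧ Submodule.span R s = C n} := fun n =>
    Nat.rec ⟨∅, linearIndepOn_empty R id, by simp [h0]⟩
      (fun n s => ⟨next n s, hli n s, hspan n s⟩) n
  have hB : Monotone fun n => (B n).1 := monotone_nat_of_le_succ fun n => hsub n (B n)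
  have hU : LinearIndepOn R id (⋃ n, (B n).1) :=
    linearIndepOn_iUnion_of_directed hB.directed_le fun n => (B n).2.1
  have hspanU : Submodule.span R (⋃ n, (B n).1) = ⨆ n, C n := by
    rw [Submodule.span_iUnion]
    exact iSup_congr fun n => (B n).2.2
  rw [← hspanU]
  have hb := Module.Basis.span (v := fun x : (⋃ n, (B n).1) => (x : M)) hU
  rw [Subtype.range_coe] at hb
  exact Module.Free.of_basis hb

end Chain

/-- **Pontryagin's criterion**, for modules over a principal ideal domain. -/
theorem Module.Free.of_countable_of_finite_pureClosure {R M : Type*} [CommRing R] [IsDomain R]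
    [IsPrincipalIdealRing R] [AddCommGroup M] [Module R M] [Module.IsTorsionFree R M] [Countable M]
    (h : ∀ N : Submodule R M, N.FG → Module.Finite R N.pureClosure) : Module.Free R M := by
  obtain ⟨e, he⟩ := exists_surjective_nat M
  let S : ℕ → Submodule R M := fun n => Submodule.span R (e '' Set.Iio n)
  have hmono : Monotone S := fun m n hmn =>
    Submodule.span_mono (Set.image_mono (Set.Iio_subset_Iio hmn))
  have hfree : Module.Free R ↥(⨆ n, (S n).pureClosure) := by
    refine Module.Free.iSup_of_free_map_mkQ
      (fun m n hmn => Submodule.pureClosure_mono (hmono hmn)) ?_ ?_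
    · rw [eq_bot_iff]
      rintro x ⟨r, hr, hx⟩
      simpa [S, hr] using hx
    · intro n
      have := Submodule.isTorsionFree_quotient_pureClosure (S n)
      have := h (S (n + 1)) (Submodule.fg_span ((Set.finite_Iio (n + 1)).image e))
      infer_instance
  have htop : ⨆ n, (S n).pureClosure = ⊤ := by
    refine eq_top_iff.2 fun x _ => ?_
    obtain ⟨n, rfl⟩ := he x
    exact le_iSup (fun n => (S n).pureClosure) (n + 1)
      (Submodule.le_pureClosure _ (Submodule.subset_span ⟨n, Nat.lt_succ_self n, rfl⟩))
  rw [htop] at hfree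
  exact Module.Free.of_equiv Submodule.topEquiv

/-- If finitely generated submodules of `M` have finitely generated pure closures, then the same
holds in every submodule of `M`. -/
theorem Submodule.finite_pureClosure_of_finite_pureClosure_map {R M : Type*} [CommRing R]
    [IsDomain R] [IsNoetherianRing R] [AddCommGroup M] [Module R M] {H : Submodule R M}
    (N : Submodule R H) (h : Module.Finite R (N.map H.subtype).pureClosure) :
    Module.Finite R N.pureClosure := by
  have hmem : ∀ x ∈ N.pureClosure, H.subtype x ∈ (N.map H.subtype).pureClosure := by
    rintro x ⟨r, hr, hx⟩
    exact ⟨r, hr, by rw [← map_smul]; exact mem_map_of_mem hx⟩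
  refine Module.Finite.of_injective (H.subtype.restrict hmem) fun x y hxy => ?_
  exact Subtype.ext (Subtype.ext (congrArg Subtype.val hxy :))

theorem Submodule.free_of_countable_of_finite_pureClosure {R M : Type*} [CommRing R] [IsDomain R]
    [IsPrincipalIdealRing R] [AddCommGroup M] [Module R M] [Module.IsTorsionFree R M]
    (h : ∀ N : Submodule R M, N.FG → Module.Finite R N.pureClosure)
    (H : Submodule R M) [Countable H] : Module.Free R H :=
  Module.Free.of_countable_of_finite_pureClosure fun N hN =>
    Submodule.finite_pureClosure_of_finite_pureClosure_map N (h _ (hN.map H.subtype))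

theorem Module.countable_of_rank_lt_aleph0 {R M : Type*} [CommRing R] [IsDomain R] [Countable R]
    [AddCommGroup M] [Module R M] [Module.IsTorsionFree R M]
    (h : Module.rank R M < Cardinal.aleph0) : Countable M := by
  obtain ⟨s, hs, hli⟩ := exists_set_linearIndependent_of_isDomain R M
  have hfin : s.Finite := Cardinal.lt_aleph0_iff_set_finite.1 (hs ▸ h)
  let N := Submodule.span R s
  have : Module.Finite R N := Module.Finite.span_of_finite R hfin
  have : Countable N := Finsupp.Countable.of_moduleFinite (R := R)
  have hrank : Module.rank R N = Module.rank R M := by rw [rank_span_set hli, hs]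
  have htors : Module.rank R (M ⧸ N) = 0 := by
    have := rank_quotient_add_rank_of_isDomain N
    rw [hrank] at this
    exact Cardinal.eq_of_add_eq_add_right (this.trans (zero_add _).symm) h
  rw [Module.rank_eq_zero_iff_isTorsion] at htors
  have hmul : ∀ x : M, ∃ r : R, r ≠ 0 ∧ r • x ∈ N := fun x => by
    obtain ⟨r, hr⟩ := @htors (N.mkQ x)
    refine ⟨r, nonZeroDivisors.ne_zero r.2, ?_⟩
    change (r : R) • N.mkQ x = 0 at hr
    rwa [← map_smul, Submodule.mkQ_apply, Submodule.Quotient.mk_eq_zero] at hr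
  choose r hr hmem using hmul
  refine Function.Injective.countable (f := fun x => (r x, (⟨r x • x, hmem x⟩ : N))) ?_
  intro x y hxy
  simp only [Prod.mk.injEq, Subtype.mk.injEq] at hxy
  rw [← hxy.1] at hxy
  exact smul_right_injective M (hr x) hxy.2

theorem Aleph1Free.isTorsionFree {G : Type*} [AddCommGroup G] (h : Aleph1Free G) :
    Module.IsTorsionFree ℤ G := by
  rw [Module.isTorsionFree_iff_smul_eq_zero]
  intro n g hng
  have := h (AddSubgroup.zmultiples g) inferInstance
  have key : n • (⟨g, AddSubgroup.mem_zmultiples g⟩ : AddSubgroup.zmultiples g) = 0 :=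
    Subtype.ext hng
  simpa [Subtype.ext_iff] using smul_eq_zero.1 key

/-- An abelian group `G` is `ℵ₁`-free if and only if `G` is torsion-free and every pure
subgroup of `G` of finite torsion-free rank is free. -/
theorem aleph1Free_iff_pure_finiteRank_free {G : Type*} [AddCommGroup G] :
    Aleph1Free G ↔
      ((∀ (g : G) (n : ℤ), n • g = 0 → g = 0 ∨ n = 0) ∧
        ∀ H : AddSubgroup G, IsPureSubgroup H →
          Module.rank ℤ ↥H < Cardinal.aleph0 → Module.Free ℤ ↥H) := by
  constructor
  · intro h
    have := h.isTorsionFree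
    refine ⟨fun g n hng => (smul_eq_zero.1 hng).symm, fun H _ hrank => h H ?_⟩
    have : Module.IsTorsionFree ℤ H :=
      H.subtype_injective.moduleIsTorsionFree H.subtype (fun n x => map_zsmul H.subtype n x)
    exact Module.countable_of_rank_lt_aleph0 hrank
  · rintro ⟨htf, h⟩ H hH
    have : Module.IsTorsionFree ℤ G :=
      Module.isTorsionFree_iff_smul_eq_zero.2 fun n g hng => (htf g n hng).symm
    have : Countable (AddSubgroup.toIntSubmodule H) := hH
    refine Submodule.free_of_countable_of_finite_pureClosure (fun N hN => ?_)
      (AddSubgroup.toIntSubmodule H)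
    have := Module.Finite.of_fg hN
    have hrank : Module.rank ℤ N.pureClosure < Cardinal.aleph0 :=
      N.rank_pureClosure.trans_lt (Module.rank_lt_aleph0 ℤ N)
    have hfree : Module.Free ℤ N.pureClosure := by
      refine h N.pureClosure.toAddSubgroup ?_ hrank
      rintro x hx n hn ⟨y, rfl⟩
      exact ⟨y, Submodule.mem_pureClosure_of_smul_mem hn hx, rfl⟩
    exact Module.rank_lt_aleph0_iff.1 hrank
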